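/- Let a > 0 and let 𝔤 = 𝒜₄,₁₁^a be the 4-dimensional real Lie algebra with brackets [e₂,e₃] = e₁, [e₁,e₄] = 2a e₁, [e₂,e₄] = a e₂ − e₃, [e₃,e₄] = e₂ + a e₃. Then for every inner product g on 𝔤 and every alternating 2-form F on 𝔤 such that (g,F) is a solution of the Einstein–Maxwell equations, the metric g is Einstein. (In fact, every F that is closed and co-closed with respect to g satisfies [F∘F]₀ = 0.) -/

import Mathlib

open scoped BigOperators

noncomputable section

/-- The underlying vector space `ℝ⁴` of the 4-dimensional Lie algebra. -/
abbrev V4 : Type := Fin 4 → ℝ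

/-- The standard basis `e₁, e₂, e₃, e₄` (0-indexed). -/
def ee (i : Fin 4) : V4 := Pi.single i 1

/-- `g` is an inner product: a positive-definite symmetric bilinear form. -/
structure IsInnerProduct (g : V4 → V4 → ℝ) : Prop where
  symm : ∀ x y, g x y = g y x
  add_left : ∀ x y z, g (x + y) z = g x z + g y z
  smul_left : ∀ (a : ℝ) (x y : V4), g (a • x) y = a * g x y
  pos : ∀ x : V4, x ≠ 0 → 0 < g x x

/-- `F` is an alternating bilinear 2-form. -/
structure IsAltForm (F : V4 → V4 → ℝ) : Prop where
  skew : ∀ x y, F x y = - F y x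
  add_left : ∀ x y z, F (x + y) z = F x z + F y z
  smul_left : ∀ (a : ℝ) (x y : V4), F (a • x) y = a * F x y

/-- Chevalley–Eilenberg differential of a 2-form with respect to the bracket `br`:
`dF(x,y,z) = −F([x,y],z) + F([x,z],y) − F([y,z],x)`. -/
def cdiff (br : V4 → V4 → V4) (F : V4 → V4 → ℝ) (x y z : V4) : ℝ :=
  - F (br x y) z + F (br x z) y - F (br y z) x

/-- A 2-form is closed if its Chevalley–Eilenberg differential vanishes. -/
def IsClosedForm (br : V4 → V4 → V4) (F : V4 → V4 → ℝ) : Prop :=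
  ∀ x y z, cdiff br F x y z = 0

/-- The Gram matrix of a bilinear form in the standard basis. -/
def gram (g : V4 → V4 → ℝ) : Matrix (Fin 4) (Fin 4) ℝ :=
  Matrix.of fun i j => g (ee i) (ee j)

/-- The inverse Gram matrix. -/
def ginv (g : V4 → V4 → ℝ) : Matrix (Fin 4) (Fin 4) ℝ := (gram g)⁻¹

/-- The inner product induced by `g` on 2-forms:
`⟨α,β⟩ = (1/2) Σ g^{ik} g^{jl} α_{ij} β_{kl}`. -/
def formInner (g : V4 → V4 → ℝ) (α β : V4 → V4 → ℝ) : ℝ :=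
  (1 / 2) * ∑ i, ∑ j, ∑ k, ∑ l,
    ginv g i k * ginv g j l * α (ee i) (ee j) * β (ee k) (ee l)

/-- The volume form of `g` for the orientation `e¹∧e²∧e³∧e⁴`. -/
def vol (g : V4 → V4 → ℝ) (x y z w : V4) : ℝ :=
  Real.sqrt (gram g).det * Matrix.det (Matrix.of fun i j => ![x, y, z, w] i j)

/-- The wedge product of two 2-forms, as a 4-form. -/
def wedge22 (α β : V4 → V4 → ℝ) (x y z w : V4) : ℝ :=
  α x y * β z w - α x z * β y w + α x w * β y z
    + α z w * β x y - α y w * β x z + α y z * β x w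

/-- `sF` is the Hodge star `⋆F` of `F` with respect to `g` and the orientation
`e¹∧e²∧e³∧e⁴`: it is the 2-form with `α ∧ sF = ⟨α,F⟩_g vol_g` for all 2-forms `α`. -/
def IsHodgeStar (g : V4 → V4 → ℝ) (F sF : V4 → V4 → ℝ) : Prop :=
  IsAltForm sF ∧
    ∀ α : V4 → V4 → ℝ, IsAltForm α → ∀ x y z w,
      wedge22 α sF x y z w = formInner g α F * vol g x y z w

/-- `F` is co-closed: `d(⋆F) = 0`. -/
def IsCoclosed (br : V4 → V4 → V4) (g F : V4 → V4 → ℝ) : Prop :=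
  ∃ sF, IsHodgeStar g F sF ∧ IsClosedForm br sF

/-- Koszul expression: `g(∇ₓy, z) = (1/2)(g([x,y],z) − g([y,z],x) + g([z,x],y))`. -/
def koszul (br : V4 → V4 → V4) (g : V4 → V4 → ℝ) (x y z : V4) : ℝ :=
  (1 / 2) * (g (br x y) z - g (br y z) x + g (br z x) y)

/-- The Levi-Civita product `∇ₓ y`, i.e. the unique vector with
`g(∇ₓy, z) = koszul x y z` for all `z` (computed via the inverse Gram matrix). -/
def LC (br : V4 → V4 → V4) (g : V4 → V4 → ℝ) (x y : V4) : V4 :=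
  fun m => ∑ k, koszul br g x y (ee k) * ginv g k m

/-- Curvature `R(x,y)z = ∇ₓ∇_y z − ∇_y∇ₓ z − ∇_{[x,y]} z`. -/
def curv (br : V4 → V4 → V4) (g : V4 → V4 → ℝ) (x y z : V4) : V4 :=
  LC br g x (LC br g y z) - LC br g y (LC br g x z) - LC br g (br x y) z

/-- Ricci tensor `Ric(x,y) = Σᵢ g(R(vᵢ,x)y, vᵢ)` for a `g`-orthonormal basis `(vᵢ)`,
i.e. the trace of the endomorphism `z ↦ R(z,x)y`. -/
def ricci (br : V4 → V4 → V4) (g : V4 → V4 → ℝ) (x y : V4) : ℝ :=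
  ∑ i, curv br g (ee i) x y i

/-- Scalar curvature: the `g`-trace of the Ricci tensor. -/
def scal (br : V4 → V4 → V4) (g : V4 → V4 → ℝ) : ℝ :=
  ∑ a, ∑ b, ginv g a b * ricci br g (ee a) (ee b)

/-- Trace-free Ricci tensor `Ric₀ = Ric − (s/4) g`. -/
def ricci0 (br : V4 → V4 → V4) (g : V4 → V4 → ℝ) (x y : V4) : ℝ :=
  ricci br g x y - (scal br g / 4) * g x y

/-- `g` is Einstein: `Ric₀ = 0`. -/
def IsEinstein (br : V4 → V4 → V4) (g : V4 → V4 → ℝ) : Prop :=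
  ∀ x y, ricci0 br g x y = 0

/-- The endomorphism `F̂` with `g(F̂x, y) = F(x,y)` (computed via the inverse Gram matrix). -/
def fhat (g F : V4 → V4 → ℝ) (x : V4) : V4 :=
  fun m => ∑ k, F x (ee k) * ginv g k m

/-- `[F∘F]₀(x,y) = g(F̂(F̂x), y) − (1/4) tr(F̂∘F̂) g(x,y)`. -/
def FF0 (g F : V4 → V4 → ℝ) (x y : V4) : ℝ :=
  g (fhat g F (fhat g F x)) y
    - (1 / 4) * (∑ i, fhat g F (fhat g F (ee i)) i) * g x y

/-- `(g, F)` is a solution of the Einstein--Maxwell equations: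
`dF = 0`, `d(⋆F) = 0`, and `Ric₀ = −[F∘F]₀`. -/
def IsEMSolution (br : V4 → V4 → V4) (g F : V4 → V4 → ℝ) : Prop :=
  IsClosedForm br F ∧ IsCoclosed br g F ∧ ∀ x y, ricci0 br g x y = - FF0 g F x y

/-- Nijenhuis tensor `N_J(x,y) = [Jx,Jy] − J[Jx,y] − J[x,Jy] − [x,y]`. -/
def nijenhuis (br : V4 → V4 → V4) (J : V4 →ₗ[ℝ] V4) (x y : V4) : V4 :=
  br (J x) (J y) - J (br (J x) y) - J (br x (J y)) - br x y

/-- The Lie algebra `𝒜₄,₁₁^a`: `[e₂,e₃] = e₁`, `[e₁,e₄] = 2a e₁`, `[e₂,e₄] = a e₂ − e₃`, `[e₃,e₄] = e₂ + a e₃`. -/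
def brA411 (a : ℝ) : V4 → V4 → V4 := fun x y =>
  ((x 1 * y 2 - x 2 * y 1) + 2 * a * (x 0 * y 3 - x 3 * y 0)) • ee 0
    + (a * (x 1 * y 3 - x 3 * y 1) + (x 2 * y 3 - x 3 * y 2)) • ee 1
    + (-(x 1 * y 3 - x 3 * y 1) + a * (x 2 * y 3 - x 3 * y 2)) • ee 2

open Matrix hiding gram

/-- The components of the metric-free dual of a 2-form: half the contraction with the
Levi-Civita symbol. -/
def dualMat (A : Matrix (Fin 4) (Fin 4) ℝ) : Matrix (Fin 4) (Fin 4) ℝ :=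
  !![0, A 2 3, -A 1 3, A 1 2;
    -A 2 3, 0, A 0 3, -A 0 2;
    A 1 3, -A 0 3, 0, A 0 1;
    -A 1 2, A 0 2, -A 0 1, 0]

/-- The Pfaffian of a skew-symmetric `4 × 4` matrix. -/
def pfaff (A : Matrix (Fin 4) (Fin 4) ℝ) : ℝ :=
  A 0 1 * A 2 3 - A 0 2 * A 1 3 + A 0 3 * A 1 2

/-- The skew-symmetric matrix with the given entries above the diagonal. -/
def skewMat (a b c d e f : ℝ) : Matrix (Fin 4) (Fin 4) ℝ :=
  !![0, a, b, c; -a, 0, d, e; -b, -d, 0, f; -c, -e, -f, 0]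

lemma eq_skewMat {A : Matrix (Fin 4) (Fin 4) ℝ} (hA : Aᵀ = -A) :
    A = skewMat (A 0 1) (A 0 2) (A 0 3) (A 1 2) (A 1 3) (A 2 3) := by
  have h (i j) : A j i = -A i j := congrFun (congrFun hA i) j
  have hd (i) : A i i = 0 := by linarith [h i i]
  ext i j
  fin_cases i <;> fin_cases j <;> first | simp [skewMat, hd]; done | simpa [skewMat] using h _ _

lemma mul_dualMat {A : Matrix (Fin 4) (Fin 4) ℝ} (hA : Aᵀ = -A) :
    A * dualMat A = (-pfaff A) • (1 : Matrix (Fin 4) (Fin 4) ℝ) := by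
  rw [eq_skewMat hA]
  ext i j
  fin_cases i <;> fin_cases j <;>
    simp [skewMat, dualMat, pfaff, Matrix.mul_apply, Fin.sum_univ_four] <;> ring

lemma dualMat_sub_smul (A B : Matrix (Fin 4) (Fin 4) ℝ) (c : ℝ) :
    dualMat (A - c • B) = dualMat A - c • dualMat B := by
  ext i j
  fin_cases i <;> fin_cases j <;> simp [dualMat] <;> ring

lemma dualMat_smul (A : Matrix (Fin 4) (Fin 4) ℝ) (c : ℝ) :
    dualMat (c • A) = c • dualMat A := by
  ext i j
  fin_cases i <;> fin_cases j <;> simp [dualMat]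

lemma dualMat_dualMat {A : Matrix (Fin 4) (Fin 4) ℝ} (hA : Aᵀ = -A) :
    dualMat (dualMat A) = A := by
  rw [eq_skewMat hA]
  ext i j
  fin_cases i <;> fin_cases j <;> simp [skewMat, dualMat]

set_option maxHeartbeats 1000000 in
lemma mul_dualMat_conj_mul (H : Matrix (Fin 4) (Fin 4) ℝ) {A : Matrix (Fin 4) (Fin 4) ℝ}
    (hA : Aᵀ = -A) : Hᵀ * dualMat (H * A * Hᵀ) * H = H.det • dualMat A := by
  rw [eq_skewMat hA]
  ext i j
  fin_cases i <;> fin_cases j <;>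
    simp [skewMat, dualMat, Matrix.mul_apply, Matrix.det_succ_row_zero,
      Fin.sum_univ_succ, Fin.succAbove] <;> ring

lemma eq_zero_of_mul_mul_eq_zero {H C : Matrix (Fin 4) (Fin 4) ℝ} (hH : H.PosDef)
    (hC : Cᵀ = -C) (h : C * H * C = 0) : C = 0 := by
  have h0 : Cᵀ * H * C = 0 := by rw [hC, neg_mul, neg_mul, h, neg_zero]
  ext i j
  by_contra hij
  have hne : (fun k => C k j) ≠ 0 := fun hz => hij (congrFun hz i)
  have hp := hH.dotProduct_mulVec_pos hne
  have hz : (Cᵀ * H * C) j j = 0 := by rw [h0]; rfl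
  simp only [Matrix.mul_apply, dotProduct, mulVec, Fin.sum_univ_four, Pi.star_apply,
    star_trivial, Matrix.transpose_apply] at hp hz
  linarith

/-- The Hodge star is an involution on 2-forms, in coordinates. -/
lemma dualMat_eq_symm {H A B : Matrix (Fin 4) (Fin 4) ℝ} {v : ℝ} (hH : Hᵀ = H)
    (hv : v ^ 2 * H.det = 1) (hA : Aᵀ = -A) (hB : Bᵀ = -B)
    (hAB : dualMat B = v • (H * A * H)) : dualMat A = v • (H * B * H) := by
  have h := mul_dualMat_conj_mul H hA
  have hB' : B = v • dualMat (H * A * H) := by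
    rw [← dualMat_smul, ← hAB, dualMat_dualMat hB]
  rw [hH] at h
  rw [hB', Matrix.mul_smul, Matrix.smul_mul, h, smul_smul, smul_smul,
    show v * v * H.det = 1 by linarith, one_smul]

lemma pfaff_eq_of_dualMat_eq {H A B : Matrix (Fin 4) (Fin 4) ℝ} {v : ℝ}
    (hA : Aᵀ = -A) (hB : Bᵀ = -B)
    (hAB : dualMat B = v • (H * A * H)) (hBA : dualMat A = v • (H * B * H)) :
    pfaff A = pfaff B := by
  have h1 := congrArg trace (mul_dualMat hA)
  have h2 := congrArg trace (mul_dualMat hB)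
  have h3 : trace (A * (H * B * H)) = trace (B * (H * A * H)) := by
    simpa only [Matrix.mul_assoc] using Matrix.trace_mul_comm (A * H) (B * H)
  rw [hBA] at h1
  rw [hAB] at h2
  simp only [Matrix.mul_smul, trace_smul, trace_one, Fintype.card_fin, smul_eq_mul] at h1 h2
  rw [h3, h2] at h1
  norm_num at h1
  linarith

/-- If `B` is the Hodge dual of `A` and `A - εB` is degenerate with `ε = ±1`, then `A * H`
squares to a multiple of the identity. -/
lemma mul_mul_mul_eq_smul_one {H A B : Matrix (Fin 4) (Fin 4) ℝ} {v ε : ℝ} (hH : H.PosDef)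
    (hv : v ≠ 0) (hA : Aᵀ = -A) (hB : Bᵀ = -B) (hε : ε * ε = 1)
    (hAB : dualMat B = v • (H * A * H)) (hBA : dualMat A = v • (H * B * H))
    (hpf : pfaff (A - ε • B) = 0) :
    ∃ c : ℝ, A * H * (A * H) = c • (1 : Matrix (Fin 4) (Fin 4) ℝ) := by
  have hε0 : ε ≠ 0 := by rintro rfl; simp at hε
  have hCt : (A - ε • B)ᵀ = -(A - ε • B) := by
    rw [transpose_sub, transpose_smul, hA, hB]; module
  have hC : A - ε • B = 0 := by
    apply eq_zero_of_mul_mul_eq_zero hH hCt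
    have h := mul_dualMat hCt
    have hD : dualMat (A - ε • B) = (-(ε * v)) • (H * (A - ε • B) * H) := by
      rw [dualMat_sub_smul, hAB, hBA, Matrix.mul_sub, Matrix.sub_mul, Matrix.mul_smul,
        Matrix.smul_mul, smul_sub, smul_smul, smul_smul,
        show -(ε * v) * ε = -v by linear_combination (-v) * hε]
      module
    rw [hD, hpf, neg_zero, zero_smul, Matrix.mul_smul, smul_eq_zero] at h
    have h' := h.resolve_left (neg_ne_zero.2 (mul_ne_zero hε0 hv))
    rw [← Matrix.mul_assoc, ← Matrix.mul_assoc] at h'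
    have h2 := congrArg (· * H⁻¹) h'
    simpa [Matrix.mul_nonsing_inv_cancel_right _ _ hH.det_pos.ne'.isUnit] using h2
  have hBeq : B = ε • A := by rw [sub_eq_zero.1 hC, smul_smul, hε, one_smul]
  refine ⟨(ε * v)⁻¹ * (-pfaff A), ?_⟩
  rw [← smul_smul, ← mul_dualMat hA, hBA, eq_inv_smul_iff₀ (mul_ne_zero hε0 hv), hBeq]
  simp only [Matrix.mul_smul, Matrix.smul_mul, smul_smul, Matrix.mul_assoc, mul_comm v ε]

namespace IsAltForm

variable {F : V4 → V4 → ℝ}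

lemma add_right (hF : IsAltForm F) (x y z : V4) : F x (y + z) = F x y + F x z := by
  rw [hF.skew, hF.add_left, hF.skew y, hF.skew z]; ring

lemma smul_right (hF : IsAltForm F) (c : ℝ) (x y : V4) : F x (c • y) = c * F x y := by
  rw [hF.skew, hF.smul_left, hF.skew y]; ring

lemma self_eq_zero (hF : IsAltForm F) (x : V4) : F x x = 0 := by
  linarith [hF.skew x x]

lemma gram_transpose (hF : IsAltForm F) : (gram F)ᵀ = -gram F := by
  ext i j
  exact hF.skew _ _

end IsAltForm

lemma eq_sum_ee (x : V4) : x = x 0 • ee 0 + x 1 • ee 1 + x 2 • ee 2 + x 3 • ee 3 := by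
  ext i
  fin_cases i <;> simp [ee]

lemma apply_eq_sum_left {B : V4 → V4 → ℝ} (hadd : ∀ x y z, B (x + y) z = B x z + B y z)
    (hsmul : ∀ (c : ℝ) (x y : V4), B (c • x) y = c * B x y) (x y : V4) :
    B x y = ∑ i, x i * B (ee i) y := by
  conv_lhs => rw [eq_sum_ee x]
  simp only [hadd, hsmul, Fin.sum_univ_four]

lemma IsInnerProduct.posDef_gram {g : V4 → V4 → ℝ} (hg : IsInnerProduct g) :
    (gram g).PosDef := by
  refine Matrix.PosDef.of_dotProduct_mulVec_pos ?_ fun x hx => ?_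
  · ext i j
    simp [gram, hg.symm (ee j)]
  · refine (hg.pos x hx).trans_eq ?_
    rw [apply_eq_sum_left hg.add_left hg.smul_left x x]
    refine Finset.sum_congr rfl fun i _ => ?_
    rw [hg.symm (ee i), apply_eq_sum_left hg.add_left hg.smul_left x (ee i)]
    simp only [Pi.star_apply, star_trivial, mulVec, dotProduct, gram, Matrix.of_apply]
    congr 1
    exact Finset.sum_congr rfl fun j _ => by rw [hg.symm (ee i), mul_comm]

/-- The elementary 2-form `eⁱ ∧ eʲ`. -/
def elemForm (i j : Fin 4) (x y : V4) : ℝ := x i * y j - x j * y i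

lemma isAltForm_elemForm (i j : Fin 4) : IsAltForm (elemForm i j) where
  skew x y := by simp only [elemForm]; ring
  add_left x y z := by simp only [elemForm, Pi.add_apply]; ring
  smul_left c x y := by simp only [elemForm, Pi.smul_apply, smul_eq_mul]; ring

lemma formInner_eq_sum (g α F : V4 → V4 → ℝ) :
    formInner g α F =
      (1 / 2) * ∑ i, ∑ j, α (ee i) (ee j) * (ginv g * gram F * (ginv g)ᵀ) i j := by
  simp only [formInner, Matrix.mul_apply, Matrix.transpose_apply, gram, Matrix.of_apply,
    Finset.sum_mul, Finset.mul_sum]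
  refine Finset.sum_congr rfl fun i _ => Finset.sum_congr rfl fun j _ => ?_
  rw [Finset.sum_comm]
  refine Finset.sum_congr rfl fun k _ => Finset.sum_congr rfl fun l _ => ?_
  ring

lemma formInner_elemForm (g : V4 → V4 → ℝ) {F : V4 → V4 → ℝ} (hF : IsAltForm F) (i j : Fin 4) :
    formInner g (elemForm i j) F = (ginv g * gram F * (ginv g)ᵀ) i j := by
  have hskew : (ginv g * gram F * (ginv g)ᵀ) j i = -(ginv g * gram F * (ginv g)ᵀ) i j := by
    have : (ginv g * gram F * (ginv g)ᵀ)ᵀ = -(ginv g * gram F * (ginv g)ᵀ) := by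
      simp [Matrix.transpose_mul, hF.gram_transpose, Matrix.mul_assoc]
    exact congrFun (congrFun this i) j
  rw [formInner_eq_sum]
  simp only [elemForm, ee, Pi.single_apply, sub_mul, Finset.sum_sub_distrib, ite_mul, mul_ite,
    one_mul, mul_one, zero_mul, mul_zero, Finset.sum_ite_eq, Finset.mem_univ, if_true]
  rw [hskew]
  ring

lemma vol_ee (g : V4 → V4 → ℝ) :
    vol g (ee 0) (ee 1) (ee 2) (ee 3) = Real.sqrt (gram g).det := by
  have : (Matrix.of fun i j => ![ee 0, ee 1, ee 2, ee 3] i j) = (1 : Matrix (Fin 4) (Fin 4) ℝ) := by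
    ext i j
    fin_cases i <;> fin_cases j <;> simp [ee]
  rw [vol, this, Matrix.det_one, mul_one]

lemma IsHodgeStar.dualMat_gram {g F S : V4 → V4 → ℝ} (hF : IsAltForm F) (h : IsHodgeStar g F S) :
    dualMat (gram S) = Real.sqrt (gram g).det • (ginv g * gram F * (ginv g)ᵀ) := by
  have key (i j : Fin 4) : wedge22 (elemForm i j) S (ee 0) (ee 1) (ee 2) (ee 3) =
      Real.sqrt (gram g).det * (ginv g * gram F * (ginv g)ᵀ) i j := by
    rw [h.2 _ (isAltForm_elemForm i j), formInner_elemForm g hF, vol_ee, mul_comm]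
  ext i j
  rw [Matrix.smul_apply, smul_eq_mul, ← key]
  fin_cases i <;> fin_cases j <;> simp [dualMat, wedge22, elemForm, ee, gram]

lemma fhat_eq_vecMul (g : V4 → V4 → ℝ) {F : V4 → V4 → ℝ} (hF : IsAltForm F) (x : V4) :
    fhat g F x = x ᵥ* (gram F * ginv g) := by
  rw [← Matrix.vecMul_vecMul]
  funext m
  simp only [fhat, Matrix.vecMul, dotProduct, gram, Matrix.of_apply]
  exact Finset.sum_congr rfl fun k _ => by rw [apply_eq_sum_left hF.add_left hF.smul_left x]

lemma FF0_eq_zero {g F : V4 → V4 → ℝ} (hg : IsInnerProduct g) (hF : IsAltForm F) {c : ℝ}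
    (h : gram F * ginv g * (gram F * ginv g) = c • (1 : Matrix (Fin 4) (Fin 4) ℝ)) (x y : V4) :
    FF0 g F x y = 0 := by
  have hsq (z : V4) : fhat g F (fhat g F z) = c • z := by
    rw [fhat_eq_vecMul g hF, fhat_eq_vecMul g hF, Matrix.vecMul_vecMul, h, Matrix.vecMul_smul,
      Matrix.vecMul_one]
  simp only [FF0, hsq, hg.smul_left]
  simp [ee]

/-- Closed 2-forms on `𝒜₄,₁₁^a` are spanned by `2a e¹⁴ + e²³`, `e²⁴` and `e³⁴`. -/
lemma gram_of_isClosedForm {a : ℝ} (ha : a ≠ 0) {F : V4 → V4 → ℝ} (hF : IsAltForm F)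
    (hc : IsClosedForm (brA411 a) F) :
    gram F 0 1 = 0 ∧ gram F 0 2 = 0 ∧ gram F 0 3 = 2 * a * gram F 1 2 := by
  have h1 := hc (ee 0) (ee 1) (ee 3)
  have h2 := hc (ee 0) (ee 2) (ee 3)
  have h3 := hc (ee 1) (ee 2) (ee 3)
  have h0 : F 0 = 0 := by
    funext y; simpa using hF.smul_left 0 0 y
  have h10 := hF.skew (ee 1) (ee 0)
  have h20 := hF.skew (ee 2) (ee 0)
  have h21 := hF.skew (ee 2) (ee 1)
  have b01 : brA411 a (ee 0) (ee 1) = 0 := by simp [brA411, ee]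
  have b02 : brA411 a (ee 0) (ee 2) = 0 := by simp [brA411, ee]
  have b03 : brA411 a (ee 0) (ee 3) = (2 * a) • ee 0 := by simp [brA411, ee]
  have b12 : brA411 a (ee 1) (ee 2) = ee 0 := by simp [brA411, ee]
  have b13 : brA411 a (ee 1) (ee 3) = a • ee 1 + (-1 : ℝ) • ee 2 := by simp [brA411, ee]
  have b23 : brA411 a (ee 2) (ee 3) = ee 1 + a • ee 2 := by simp [brA411, ee]
  simp only [cdiff, b01, b02, b03, b12, b13, b23, hF.add_left, hF.smul_left, h0, Pi.zero_apply,
    hF.self_eq_zero, h10, h20, h21] at h1 h2 h3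
  have hpos : 9 * a ^ 2 + 1 ≠ 0 := by positivity
  have h01 : F (ee 0) (ee 1) = 0 := by
    refine (mul_eq_zero.1 ?_).resolve_left hpos
    linear_combination 3 * a * h1 + h2
  refine ⟨h01, ?_, ?_⟩ <;> simp only [gram, Matrix.of_apply]
  · linear_combination 3 * a * h01 - h1
  · linear_combination -h3

lemma FF0_eq_zero_of_closed_of_coclosed {a : ℝ} (ha : a ≠ 0) {g F : V4 → V4 → ℝ}
    (hg : IsInnerProduct g) (hF : IsAltForm F) (hc : IsClosedForm (brA411 a) F)
    (hcc : IsCoclosed (brA411 a) g F) (x y : V4) : FF0 g F x y = 0 := by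
  obtain ⟨S, hS, hSc⟩ := hcc
  have hG := hg.posDef_gram
  have hH : (ginv g).PosDef := hG.inv
  have hHt : (ginv g)ᵀ = ginv g := by simpa using hH.isHermitian.eq
  have hdet := hG.det_pos
  have hA := hF.gram_transpose
  have hB := hS.1.gram_transpose
  have hAB := hS.dualMat_gram hF
  rw [hHt] at hAB
  have hv : Real.sqrt (gram g).det ^ 2 * (ginv g).det = 1 := by
    rw [Real.sq_sqrt hdet.le, ginv, Matrix.det_nonsing_inv,
      Ring.mul_inverse_cancel _ hdet.ne'.isUnit]
  have hBA := dualMat_eq_symm hHt hv hA hB hAB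
  have hpf := pfaff_eq_of_dualMat_eq hA hB hAB hBA
  obtain ⟨f1, f2, f3⟩ := gram_of_isClosedForm ha hF hc
  obtain ⟨s1, s2, s3⟩ := gram_of_isClosedForm ha hS.1 hSc
  obtain ⟨ε, hε, hp⟩ : ∃ ε : ℝ, ε * ε = 1 ∧ gram F 1 2 = ε * gram S 1 2 := by
    have hsq : gram F 1 2 ^ 2 = gram S 1 2 ^ 2 := by
      simp only [pfaff, f1, f2, f3, s1, s2, s3] at hpf
      refine mul_left_cancel₀ (mul_ne_zero two_ne_zero ha) ?_
      linear_combination hpf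
    rcases sq_eq_sq_iff_eq_or_eq_neg.1 hsq with h | h
    · exact ⟨1, by norm_num, by linarith⟩
    · exact ⟨-1, by norm_num, by linarith⟩
  have hpf0 : pfaff (gram F - ε • gram S) = 0 := by
    simp [pfaff, f1, f2, s1, s2, hp]
  obtain ⟨c, hcsq⟩ :=
    mul_mul_mul_eq_smul_one hH (Real.sqrt_pos.2 hdet).ne' hA hB hε hAB hBA hpf0
  exact FF0_eq_zero hg hF hcsq x y

/-- `𝒜₄,₁₁^a` (`a > 0`) admits no left-invariant non-Einstein solution to the Einstein--Maxwell equations; in fact every closed and co-closed `F` satisfies `[F∘F]₀ = 0`. -/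
theorem stmt17 (a : ℝ) (ha : 0 < a) :
    (∀ g F : V4 → V4 → ℝ, IsInnerProduct g → IsAltForm F →
      IsEMSolution (brA411 a) g F → IsEinstein (brA411 a) g) ∧
    (∀ g F : V4 → V4 → ℝ, IsInnerProduct g → IsAltForm F →
      IsClosedForm (brA411 a) F → IsCoclosed (brA411 a) g F → ∀ x y, FF0 g F x y = 0) := by
  refine ⟨fun g F hg hF h x y => ?_, fun g F hg hF => FF0_eq_zero_of_closed_of_coclosed ha.ne' hg hF⟩
  rw [h.2.2, FF0_eq_zero_of_closed_of_coclosed ha.ne' hg hF h.1 h.2.1, neg_zero]
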